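/- For all A, B ∈ ℤ*: (0, 0, A) ~ (0, 0, B) if and only if A ~ B, where (0, 0, A) denotes the sequence A with two 0's prepended. -/

import Mathlib

/-- `Y` is a blowing-up of the finite integer sequence `X`. -/
inductive SeqBlowup : List ℤ → List ℤ → Prop
  | empty : SeqBlowup [] [-1]
  | left (x : ℤ) (l : List ℤ) : SeqBlowup (x :: l) (-1 :: (x - 1) :: l)
  | mid (A B : List ℤ) (a b : ℤ) :
      SeqBlowup (A ++ a :: b :: B) (A ++ (a - 1) :: -1 :: (b - 1) :: B)
  | right (l : List ℤ) (x : ℤ) : SeqBlowup (l ++ [x]) (l ++ [x - 1, -1])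

/-- Two sequences are equivalent if one is obtained from the other by a finite
sequence of blowings-up and blowings-down. -/
def SeqEquiv (X Y : List ℤ) : Prop := Relation.EqvGen SeqBlowup X Y

/-- Decrease the first term, if there is one, by `1`. -/
def decHead : List ℤ → List ℤ
  | [] => []
  | x :: l => (x - 1) :: l

/-- The blowings-up other than the one at the left end. -/
inductive InnerBlowup : List ℤ → List ℤ → Prop
  | head (x : ℤ) (l : List ℤ) : InnerBlowup (x :: l) ((x - 1) :: -1 :: decHead l)
  | cons (x : ℤ) {l m : List ℤ} : InnerBlowup l m → InnerBlowup (x :: l) (x :: m)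

theorem InnerBlowup.append_left (A : List ℤ) {l m : List ℤ} (h : InnerBlowup l m) :
    InnerBlowup (A ++ l) (A ++ m) := by
  induction A with
  | nil => exact h
  | cons x A ih => exact ih.cons x

theorem InnerBlowup.decHead {l m : List ℤ} (h : InnerBlowup l m) :
    InnerBlowup (decHead l) (decHead m) := by
  cases h with
  | head x l => exact .head _ _
  | cons x h => exact h.cons _

theorem SeqBlowup.of_decHead (l : List ℤ) : SeqBlowup l (-1 :: decHead l) := by
  cases l with
  | nil => exact .empty
  | cons x l => exact .left x l

theorem InnerBlowup.exists_append {l m : List ℤ} (h : InnerBlowup l m) :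
    ∃ A x B, l = A ++ x :: B ∧ m = A ++ (x - 1) :: -1 :: _root_.decHead B := by
  induction h with
  | head x l => exact ⟨[], x, l, rfl, rfl⟩
  | cons y _ ih =>
    obtain ⟨A, x, B, rfl, rfl⟩ := ih
    exact ⟨y :: A, x, B, rfl, rfl⟩

theorem InnerBlowup.seqBlowup {l m : List ℤ} (h : InnerBlowup l m) : SeqBlowup l m := by
  obtain ⟨A, x, B, rfl, rfl⟩ := h.exists_append
  cases B with
  | nil => exact .right A x
  | cons y B => exact .mid A B x y

theorem seqBlowup_iff {l m : List ℤ} :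
    SeqBlowup l m ↔ m = -1 :: decHead l ∨ InnerBlowup l m := by
  constructor
  · intro h
    cases h with
    | empty => exact .inl rfl
    | left x l => exact .inl rfl
    | mid A B a b => exact .inr ((InnerBlowup.head a (b :: B)).append_left A)
    | right l x => exact .inr ((InnerBlowup.head x []).append_left l)
  · rintro (rfl | h)
    · exact .of_decHead l
    · exact h.seqBlowup

theorem InnerBlowup.diamond {l m n : List ℤ} (hm : InnerBlowup l m) (hn : InnerBlowup l n) :
    m = n ∨ ∃ k, InnerBlowup m k ∧ InnerBlowup n k := by
  induction hm generalizing n with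
  | head x l =>
    cases hn with
    | head => exact .inl rfl
    | cons _ h => exact .inr ⟨_, (h.decHead.cons _).cons _, .head _ _⟩
  | cons x h ih =>
    cases hn with
    | head => exact .inr ⟨_, .head _ _, (h.decHead.cons _).cons _⟩
    | cons _ h' =>
      rcases ih h' with rfl | ⟨k, h₁, h₂⟩
      · exact .inl rfl
      · exact .inr ⟨_, h₁.cons _, h₂.cons _⟩

theorem SeqBlowup.diamond {l m n : List ℤ} (hm : SeqBlowup l m) (hn : SeqBlowup l n) :
    m = n ∨ ∃ k, SeqBlowup m k ∧ SeqBlowup n k := by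
  rcases seqBlowup_iff.1 hm with rfl | hm <;> rcases seqBlowup_iff.1 hn with rfl | hn
  · exact .inl rfl
  · exact .inr ⟨_, (hn.decHead.cons _).seqBlowup, .of_decHead _⟩
  · exact .inr ⟨_, .of_decHead _, (hm.decHead.cons _).seqBlowup⟩
  · rcases hm.diamond hn with rfl | ⟨k, h₁, h₂⟩
    · exact .inl rfl
    · exact .inr ⟨k, h₁.seqBlowup, h₂.seqBlowup⟩

/-- Equivalent sequences have a common iterated blowing-up. -/
theorem SeqEquiv.join {X Y : List ℤ} (h : SeqEquiv X Y) :
    Relation.Join (Relation.ReflTransGen SeqBlowup) X Y := by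
  have church_rosser : ∀ l m n, SeqBlowup l m → SeqBlowup l n →
      ∃ k, Relation.ReflGen SeqBlowup m k ∧ Relation.ReflTransGen SeqBlowup n k := by
    intro l m n hm hn
    rcases hm.diamond hn with rfl | ⟨k, h₁, h₂⟩
    · exact ⟨m, .refl, .refl⟩
    · exact ⟨k, .single h₁, .single h₂⟩
  have equiv := Relation.equivalence_join_reflTransGen church_rosser
  induction h with
  | rel X Y h => exact ⟨Y, .single h, .refl⟩
  | refl X => exact equiv.refl X
  | symm X Y _ ih => exact equiv.symm ih
  | trans X Y Z _ _ ih₁ ih₂ => exact equiv.trans ih₁ ih₂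

/-- For `l = (x₁, …, xₙ)`, the sequence `y₀ = a`, `y₁ = b`, `yᵢ₊₁ = -xᵢ yᵢ - yᵢ₋₁` has
`y₁, …, yₙ` positive and `yₙ₊₁ = 0`. -/
def FirstZeroAtEnd : ℤ → ℤ → List ℤ → Prop
  | _, b, [] => b = 0
  | a, b, x :: l => 0 < b ∧ FirstZeroAtEnd b (-x * b - a) l

theorem FirstZeroAtEnd.eq_of_append_cons_eq {a b c d : ℤ} {l m r s : List ℤ}
    (hl : FirstZeroAtEnd a b l) (hm : FirstZeroAtEnd a b m) (h : l ++ c :: r = m ++ d :: s) :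
    r = s := by
  induction l generalizing a b m with
  | nil =>
    cases m with
    | nil => simpa using (List.cons.inj h).2
    | cons y m => exact absurd hl hm.1.ne'
  | cons x l ih =>
    cases m with
    | nil => exact absurd hm hl.1.ne'
    | cons y m =>
      obtain ⟨rfl, htail⟩ := List.cons.inj h
      exact ih hl.2 hm.2 htail

theorem FirstZeroAtEnd.decHead {x : ℤ} {l : List ℤ} (h : FirstZeroAtEnd 0 1 (x :: l)) :
    FirstZeroAtEnd 0 1 (-1 :: (x - 1) :: l) := by
  refine ⟨one_pos, by norm_num, ?_⟩
  convert h.2 using 1 <;> ring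

/-- An inner blowing-up of `(l, c, r)`, where `l` satisfies `FirstZeroAtEnd a b`, blows up the
part after `c` at most once and keeps that property of the part before it. -/
theorem InnerBlowup.exists_split {a b c : ℤ} {l r m : List ℤ} (hl : FirstZeroAtEnd a b l)
    (h : InnerBlowup (l ++ c :: r) m) :
    ∃ l' c' r', m = l' ++ c' :: r' ∧ FirstZeroAtEnd a b l' ∧
      Relation.ReflTransGen SeqBlowup r r' := by
  induction l generalizing a b m with
  | nil =>
    cases h with
    | head => exact ⟨[], c - 1, _, rfl, hl, .single (.of_decHead r)⟩
    | cons _ h => exact ⟨[], c, _, rfl, hl, .single h.seqBlowup⟩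
  | cons x l ih =>
    obtain ⟨hb, hl⟩ := hl
    cases h with
    | head =>
      cases l with
      | nil =>
        refine ⟨[x - 1, -1], c - 1, r, rfl, ⟨hb, ?_, ?_⟩, .refl⟩
        · have h0 : -x * b - a = 0 := hl
          linarith
        · have h0 : -x * b - a = 0 := hl
          change _ = _
          linarith
      | cons y l =>
        obtain ⟨ht, hl⟩ := hl
        refine ⟨(x - 1) :: -1 :: (y - 1) :: l, c, r, rfl, ⟨hb, ?_, ?_, ?_⟩, .refl⟩
        · linarith
        · linarith
        · convert hl using 1 <;> ring
    | cons _ h =>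
      obtain ⟨l', c', r', rfl, h', hr⟩ := ih hl h
      exact ⟨x :: l', c', r', rfl, ⟨hb, h'⟩, hr⟩

theorem SeqBlowup.exists_split {c : ℤ} {l r m : List ℤ} (hl : FirstZeroAtEnd 0 1 l)
    (h : SeqBlowup (l ++ c :: r) m) :
    ∃ l' c' r', m = l' ++ c' :: r' ∧ FirstZeroAtEnd 0 1 l' ∧
      Relation.ReflTransGen SeqBlowup r r' := by
  rcases seqBlowup_iff.1 h with rfl | h
  · cases l with
    | nil => exact absurd hl one_ne_zero
    | cons x l => exact ⟨-1 :: (x - 1) :: l, c, r, rfl, hl.decHead, .refl⟩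
  · exact h.exists_split hl

theorem exists_split_of_reflTransGen {A Z : List ℤ}
    (h : Relation.ReflTransGen SeqBlowup (0 :: 0 :: A) Z) :
    ∃ l c r, Z = l ++ c :: r ∧ FirstZeroAtEnd 0 1 l ∧ Relation.ReflTransGen SeqBlowup A r := by
  induction h with
  | refl => exact ⟨[0], 0, A, rfl, ⟨one_pos, by norm_num [FirstZeroAtEnd]⟩, .refl⟩
  | tail _ h ih =>
    obtain ⟨l, c, r, rfl, hl, hr⟩ := ih
    obtain ⟨l', c', r', rfl, hl', hr'⟩ := h.exists_split hl
    exact ⟨l', c', r', rfl, hl', hr.trans hr'⟩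

theorem seqEquiv_zero_cons_add_one (a : ℤ) (l : List ℤ) :
    SeqEquiv (0 :: a :: l) (0 :: (a + 1) :: l) := by
  refine .trans _ _ _ (.rel _ _ (.left 0 (a :: l))) (.symm _ _ (.rel _ _ ?_))
  simpa using SeqBlowup.mid [] l 0 (a + 1)

theorem SeqBlowup.seqEquiv_cons_two_zeros {A B : List ℤ} (h : SeqBlowup A B) :
    SeqEquiv (0 :: 0 :: A) (0 :: 0 :: B) := by
  rcases seqBlowup_iff.1 h with rfl | h
  · exact .trans _ _ _ (seqEquiv_zero_cons_add_one 0 A)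
      (.rel _ _ ((InnerBlowup.head 1 A).cons 0).seqBlowup)
  · exact .rel _ _ ((h.cons 0).cons 0).seqBlowup

/-- **Lemma.** `(0, 0, A) ~ (0, 0, B)` iff `A ~ B`. -/
theorem seqEquiv_cons_two_zeros_iff (A B : List ℤ) :
    SeqEquiv (0 :: 0 :: A) (0 :: 0 :: B) ↔ SeqEquiv A B := by
  constructor
  · intro h
    obtain ⟨Z, hA, hB⟩ := h.join
    obtain ⟨l, c, r, rfl, hl, hAr⟩ := exists_split_of_reflTransGen hA
    obtain ⟨m, d, s, h, hm, hBs⟩ := exists_split_of_reflTransGen hB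
    obtain rfl := hl.eq_of_append_cons_eq hm h
    exact .trans _ _ _ (Relation.EqvGen.reflTransGen_le_eqvGen SeqBlowup _ _ hAr)
      (.symm _ _ (Relation.EqvGen.reflTransGen_le_eqvGen SeqBlowup _ _ hBs))
  · intro h
    induction h with
    | rel X Y h => exact h.seqEquiv_cons_two_zeros
    | refl X => exact .refl _
    | symm X Y _ ih => exact .symm _ _ ih
    | trans X Y Z _ _ ih₁ ih₂ => exact .trans _ _ _ ih₁ ih₂
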